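/- Let V : (0,2] → ℝ be defined by V(r) = (−13 + 73t + 5t² + 7t³ + t⁵)/120 + 7(t+1)(t+1/2)² t² (t−1/2)² / (120(1−t)), where t = 1 − r²/2. Then the hypercube is the unique global minimizer of E_V among 16-point configurations on the unit sphere S³ ⊂ ℝ⁴: for every 16-point configuration C on S³, E_V(C) ≥ E_V(hypercube), and equality holds only if C is the image of the hypercube configuration under an orthogonal transformation of ℝ⁴. -/

import Mathlib

open scoped Classical

/-- The `V`-potential energy of a finite configuration `C`:
`E_V(C) = (1/2) ∑_{x,y ∈ C, x ≠ y} V(|x-y|)`. -/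
noncomputable def energy {n : ℕ} (V : ℝ → ℝ) (C : Finset (EuclideanSpace ℝ (Fin n))) : ℝ :=
  (1 / 2) * ∑ x ∈ C, ∑ y ∈ C, if x = y then 0 else V (dist x y)

/-- The distance distribution of a finite configuration: `d_C(r)` is the number of
unordered pairs of distinct points of `C` at Euclidean distance `r`. -/
noncomputable def distDistrib {n : ℕ} (C : Finset (EuclideanSpace ℝ (Fin n))) : ℝ → ℝ :=
  fun r => ((C ×ˢ C).filter fun p => p.1 ≠ p.2 ∧ dist p.1 p.2 = r).card / 2

/-- `C` lies on the unit sphere `S^{n-1}`. -/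
def onSphere {n : ℕ} (C : Finset (EuclideanSpace ℝ (Fin n))) : Prop :=
  ∀ x ∈ C, ‖x‖ = 1

/-- `C'` is the image of `C` under an orthogonal transformation of `ℝ^n`. -/
def isOrthImage {n : ℕ} (C C' : Finset (EuclideanSpace ℝ (Fin n))) : Prop :=
  ∃ O : EuclideanSpace ℝ (Fin n) ≃ₗᵢ[ℝ] EuclideanSpace ℝ (Fin n), C' = C.image O

/-- The hypercube configuration: the 16 points `(±1/2, ±1/2, ±1/2, ±1/2)` on `S³`. -/
noncomputable def hypercubeConfig : Finset (EuclideanSpace ℝ (Fin 4)) :=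
  Finset.image (fun s : Fin 4 → Bool =>
    (WithLp.equiv 2 (Fin 4 → ℝ)).symm
      (fun i => if s i then (1 : ℝ) / 2 else -(1 / 2))) Finset.univ

/-- The potential of Theorem 4 (the hypercube theorem), as a function of the inner
product `t = 1 - r²/2`. -/
noncomputable def hypercubeW : ℝ → ℝ := fun t =>
  (-13 + 73 * t + 5 * t ^ 2 + 7 * t ^ 3 + t ^ 5) / 120 +
    7 * (t + 1) * (t + 1 / 2) ^ 2 * t ^ 2 * (t - 1 / 2) ^ 2 / (120 * (1 - t))

/-- The potential of Theorem 4 (the hypercube theorem). -/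
noncomputable def hypercubeV : ℝ → ℝ := fun r => hypercubeW (1 - r ^ 2 / 2)

lemma inner_pow_eq_sum {n : ℕ} (x y : EuclideanSpace ℝ (Fin n)) (k : ℕ) :
    (inner ℝ x y) ^ k = ∑ f : Fin k → Fin n, (∏ j, x (f j)) * ∏ j, y (f j) := by
  rw [PiLp.inner_apply, Fintype.sum_pow]
  refine Finset.sum_congr rfl fun f _ => ?_
  rw [← Finset.prod_mul_distrib]
  refine Finset.prod_congr rfl fun j _ => ?_
  simp [mul_comm]

/-- The sum of the `k`-th powers of all inner products is a sum of squares of moments. -/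
lemma sum_inner_pow {n : ℕ} (C : Finset (EuclideanSpace ℝ (Fin n))) (k : ℕ) :
    ∑ x ∈ C, ∑ y ∈ C, (inner ℝ x y) ^ k =
      ∑ f : Fin k → Fin n, (∑ x ∈ C, ∏ j, x (f j)) ^ 2 := by
  simp_rw [inner_pow_eq_sum, sq, Finset.sum_mul_sum]
  rw [Finset.sum_comm]
  conv_rhs => rw [Finset.sum_comm]
  rw [Finset.sum_comm]
  refine Finset.sum_congr rfl fun x _ => ?_
  rw [Finset.sum_comm]

lemma sum_inner_pow_nonneg {n : ℕ} (C : Finset (EuclideanSpace ℝ (Fin n))) (k : ℕ) :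
    0 ≤ ∑ x ∈ C, ∑ y ∈ C, (inner ℝ x y) ^ k := by
  rw [sum_inner_pow]
  positivity

/-- If the `k`-th moments vanish in the aggregate, they vanish against every vector. -/
lemma sum_inner_pow_eq_zero {n : ℕ} {C : Finset (EuclideanSpace ℝ (Fin n))} {k : ℕ}
    (h : ∑ x ∈ C, ∑ y ∈ C, (inner ℝ x y) ^ k = 0) (u : EuclideanSpace ℝ (Fin n)) :
    ∑ x ∈ C, (inner ℝ u x) ^ k = 0 := by
  rw [sum_inner_pow, Finset.sum_eq_zero_iff_of_nonneg (fun _ _ => sq_nonneg _)] at h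
  simp_rw [inner_pow_eq_sum]
  rw [Finset.sum_comm]
  refine Finset.sum_eq_zero fun f _ => ?_
  rw [← Finset.mul_sum, pow_eq_zero_iff (two_ne_zero) |>.1 (h f (Finset.mem_univ f)), mul_zero]

lemma sum_sq_coord {C : Finset (EuclideanSpace ℝ (Fin 4))} (hC : onSphere C) :
    ∑ i, ∑ x ∈ C, x i * x i = C.card := by
  rw [Finset.sum_comm, Finset.card_eq_sum_ones, Nat.cast_sum]
  refine Finset.sum_congr rfl fun x hx => ?_
  have := EuclideanSpace.real_norm_sq_eq x
  rw [hC x hx] at this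
  simp_rw [← sq, ← this]
  norm_num

/-- The Frobenius distance of the second-moment matrix from `4 I`. -/
lemma sum_inner_sq {C : Finset (EuclideanSpace ℝ (Fin 4))} (hcard : C.card = 16)
    (hC : onSphere C) :
    ∑ x ∈ C, ∑ y ∈ C, (inner ℝ x y) ^ 2 =
      64 + ∑ i, ∑ j, ((∑ x ∈ C, x i * x j) - if i = j then 4 else 0) ^ 2 := by
  have h1 : ∑ x ∈ C, ∑ y ∈ C, (inner ℝ x y) ^ 2 = ∑ i, ∑ j, (∑ x ∈ C, x i * x j) ^ 2 := by
    simp_rw [PiLp.inner_apply, sq, Finset.sum_mul_sum]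
    rw [← Finset.sum_product', Finset.sum_comm]
    refine Finset.sum_congr rfl fun i _ => ?_
    rw [Finset.sum_comm]
    refine Finset.sum_congr rfl fun j _ => ?_
    rw [Finset.sum_product]
    refine Finset.sum_congr rfl fun x _ => Finset.sum_congr rfl fun y _ => ?_
    simp
    ring
  have h2 := sum_sq_coord hC
  rw [hcard] at h2
  rw [h1]
  simp [Fin.sum_univ_four] at h2 ⊢
  linear_combination 8 * h2

/-- A second-moment matrix equal to `4 I` means that the configuration is a tight frame. -/
lemma sum_inner_smul {C : Finset (EuclideanSpace ℝ (Fin 4))} (hcard : C.card = 16)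
    (hC : onSphere C) (h : ∑ x ∈ C, ∑ y ∈ C, (inner ℝ x y) ^ 2 = 64)
    (u : EuclideanSpace ℝ (Fin 4)) :
    ∑ z ∈ C, (inner ℝ u z) • z = (4 : ℝ) • u := by
  rw [sum_inner_sq hcard hC, add_eq_left,
    Finset.sum_eq_zero_iff_of_nonneg (fun _ _ => Finset.sum_nonneg fun _ _ => sq_nonneg _)] at h
  have hcase : ∀ i j, ∑ x ∈ C, x i * x j = if i = j then 4 else 0 := by
    intro i j
    have := (Finset.sum_eq_zero_iff_of_nonneg (fun _ _ => sq_nonneg _)).1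
      (h i (Finset.mem_univ i)) j (Finset.mem_univ j)
    exact sub_eq_zero.1 (pow_eq_zero_iff two_ne_zero |>.1 this)
  ext i
  have h3 : (∑ z ∈ C, (inner ℝ u z) • z) i = ∑ j, u j * ∑ x ∈ C, x j * x i := by
    simp_rw [Finset.mul_sum]
    rw [Finset.sum_comm, WithLp.ofLp_sum, Finset.sum_apply]
    refine Finset.sum_congr rfl fun z _ => ?_
    simp only [PiLp.smul_apply, PiLp.inner_apply, smul_eq_mul, Finset.sum_mul]
    refine Finset.sum_congr rfl fun j _ => ?_
    simp
    ring
  rw [h3]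
  simp [hcase, mul_comm]

/-- The part of `hypercubeW` beyond its linear programming minorant. -/
noncomputable def hypercubeR (t : ℝ) : ℝ :=
  7 * (t + 1) * (t + 1 / 2) ^ 2 * t ^ 2 * (t - 1 / 2) ^ 2 / (120 * (1 - t))

lemma hypercubeR_nonneg {t : ℝ} (h1 : -1 ≤ t) (h2 : t ≤ 1) : 0 ≤ hypercubeR t := by
  unfold hypercubeR
  have : 0 ≤ t + 1 := by linarith
  have : 0 ≤ 1 - t := by linarith
  positivity

lemma hypercubeR_eq_zero {t : ℝ} (h : hypercubeR t = 0) (h1 : t ≠ 1) :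
    t = 1 / 2 ∨ t = 0 ∨ t = -1 / 2 ∨ t = -1 := by
  have : (1 - t) ≠ 0 := sub_ne_zero.2 h1.symm
  simp only [hypercubeR, div_eq_zero_iff, mul_eq_zero, ne_eq, OfNat.ofNat_ne_zero,
    not_false_eq_true, pow_eq_zero_iff, this, false_or, or_false] at h
  rcases h with ((h | h) | h) | h
  · exact Or.inr (Or.inr (Or.inr (by linarith)))
  · exact Or.inr (Or.inr (Or.inl (by linarith)))
  · exact Or.inr (Or.inl h)
  · exact Or.inl (by linarith)

lemma one_sub_dist_sq {x y : EuclideanSpace ℝ (Fin 4)} (hx : ‖x‖ = 1) (hy : ‖y‖ = 1) :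
    1 - dist x y ^ 2 / 2 = inner ℝ x y := by
  rw [dist_eq_norm, norm_sub_sq_real, hx, hy]
  ring

lemma energy_hypercubeV {C : Finset (EuclideanSpace ℝ (Fin 4))} (hcard : C.card = 16)
    (hC : onSphere C) :
    energy hypercubeV C = 1 / 2 * ((∑ x ∈ C, ∑ y ∈ C, if x = y then 0 else
        hypercubeR (inner ℝ x y)) +
      (73 * ∑ x ∈ C, ∑ y ∈ C, (inner ℝ x y) ^ 1 + 7 * ∑ x ∈ C, ∑ y ∈ C, (inner ℝ x y) ^ 3 +
        ∑ x ∈ C, ∑ y ∈ C, (inner ℝ x y) ^ 5 +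
        5 * ((∑ x ∈ C, ∑ y ∈ C, (inner ℝ x y) ^ 2) - 64) - 4176) / 120) := by
  have key : ∀ x ∈ C, ∀ y ∈ C, (if x = y then 0 else hypercubeV (dist x y)) =
      (if x = y then 0 else hypercubeR (inner ℝ x y)) + (73 * (inner ℝ x y) ^ 1 +
        7 * (inner ℝ x y) ^ 3 + (inner ℝ x y) ^ 5 + 5 * (inner ℝ x y) ^ 2 - 13) / 120
        - if x = y then 73 / 120 else 0 := by
    intro x hx y hy
    split_ifs with h
    · subst h
      rw [real_inner_self_eq_norm_sq, hC x hx]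
      norm_num
    · rw [hypercubeV, one_sub_dist_sq (hC x hx) (hC y hy), hypercubeW, hypercubeR]
      ring
  rw [energy, Finset.sum_congr rfl fun x hx => Finset.sum_congr rfl (key x hx)]
  simp only [Finset.sum_sub_distrib, Finset.sum_add_distrib, ← Finset.sum_div, ← Finset.mul_sum,
    Finset.sum_const, hcard, Finset.sum_ite_eq, Finset.sum_ite_mem, Finset.inter_self]
  norm_num
  ring

lemma energy_hypercubeConfig : energy hypercubeV hypercubeConfig = -87 / 5 := by
  have hinj : Function.Injective (fun s : Fin 4 → Bool =>
      (WithLp.equiv 2 (Fin 4 → ℝ)).symm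
        (fun i => if s i then (1 : ℝ) / 2 else -(1 / 2))) := by
    intro s t h
    funext i
    have := congrFun ((WithLp.equiv 2 (Fin 4 → ℝ)).symm.injective h) i
    revert this
    cases s i <;> cases t i <;> norm_num
  have hdist : ∀ s t : Fin 4 → Bool, dist
      ((WithLp.equiv 2 (Fin 4 → ℝ)).symm (fun i => if s i then (1 : ℝ) / 2 else -(1 / 2)))
      ((WithLp.equiv 2 (Fin 4 → ℝ)).symm (fun i => if t i then (1 : ℝ) / 2 else -(1 / 2))) ^ 2 =
      hammingDist s t := by
    intro s t
    rw [EuclideanSpace.dist_eq, Real.sq_sqrt (by positivity), hammingDist,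
      Finset.card_filter, Nat.cast_sum]
    refine Finset.sum_congr rfl fun i _ => ?_
    simp only [WithLp.equiv_symm_apply, Real.dist_eq, sq_abs]
    cases s i <;> cases t i <;> norm_num
  have hcount : ∀ s : Fin 4 → Bool, Finset.univ.val.map (fun t => hammingDist s t) =
      {0, 1, 1, 1, 1, 2, 2, 2, 2, 2, 2, 3, 3, 3, 3, 4} := by decide
  let g : ℕ → ℝ := fun k => if k = 0 then 0 else hypercubeW (1 - k / 2)
  have hrow : ∀ s : Fin 4 → Bool, ∑ t, g (hammingDist s t) = -261 / 120 := by
    intro s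
    have : ∑ t, g (hammingDist s t) =
        ((Finset.univ.val.map (fun t => hammingDist s t)).map g).sum := by
      rw [Multiset.map_map]; rfl
    rw [this, hcount]
    simp [g, hypercubeW]
    norm_num
  rw [energy, hypercubeConfig, Finset.sum_image hinj.injOn]
  have : ∀ s t : Fin 4 → Bool, (if
      (WithLp.equiv 2 (Fin 4 → ℝ)).symm (fun i => if s i then (1 : ℝ) / 2 else -(1 / 2)) =
      (WithLp.equiv 2 (Fin 4 → ℝ)).symm (fun i => if t i then (1 : ℝ) / 2 else -(1 / 2))
      then 0 else hypercubeV (dist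
      ((WithLp.equiv 2 (Fin 4 → ℝ)).symm (fun i => if s i then (1 : ℝ) / 2 else -(1 / 2)))
      ((WithLp.equiv 2 (Fin 4 → ℝ)).symm (fun i => if t i then (1 : ℝ) / 2 else -(1 / 2))))) =
      g (hammingDist s t) := by
    intro s t
    have h := hinj.eq_iff (a := s) (b := t)
    simp only [h, g, hammingDist_eq_zero, hypercubeV, hdist]
  simp_rw [Finset.sum_image hinj.injOn, this, hrow]
  norm_num

/-- The properties forced on a configuration by equality in the linear programming bound. -/
structure IsTightConfig (C : Finset (EuclideanSpace ℝ (Fin 4))) : Prop where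
  card_eq : C.card = 16
  norm_eq : onSphere C
  inner_mem : ∀ x ∈ C, ∀ y ∈ C, x ≠ y →
    inner ℝ x y = 1 / 2 ∨ inner ℝ x y = 0 ∨ inner ℝ x y = -1 / 2 ∨ inner ℝ x y = -1
  sum_inner : ∀ u, ∑ z ∈ C, (inner ℝ u z) = 0
  sum_inner_cube : ∀ u, ∑ z ∈ C, (inner ℝ u z) ^ 3 = 0
  frame : ∀ u, ∑ z ∈ C, (inner ℝ u z) • z = (4 : ℝ) • u

lemma isTightConfig_of_energy_le {C : Finset (EuclideanSpace ℝ (Fin 4))} (hcard : C.card = 16)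
    (hC : onSphere C) : -87 / 5 ≤ energy hypercubeV C ∧
      (energy hypercubeV C = -87 / 5 → IsTightConfig C) := by
  have hE := energy_hypercubeV hcard hC
  have h1 := sum_inner_pow_nonneg C 1
  have h3 := sum_inner_pow_nonneg C 3
  have h5 := sum_inner_pow_nonneg C 5
  have h2 : 64 ≤ ∑ x ∈ C, ∑ y ∈ C, (inner ℝ x y) ^ 2 := by
    rw [sum_inner_sq hcard hC, le_add_iff_nonneg_right]
    positivity
  have hterm : ∀ x ∈ C, ∀ y ∈ C, 0 ≤ if x = y then 0 else hypercubeR (inner ℝ x y) := by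
    intro x hx y hy
    have := abs_le.1 (abs_real_inner_le_norm x y)
    rw [hC x hx, hC y hy, mul_one] at this
    split_ifs
    · exact le_rfl
    · exact hypercubeR_nonneg this.1 this.2
  have hr : 0 ≤ ∑ x ∈ C, ∑ y ∈ C, if x = y then 0 else hypercubeR (inner ℝ x y) :=
    Finset.sum_nonneg fun x hx => Finset.sum_nonneg (hterm x hx)
  refine ⟨by linarith, fun h => ?_⟩
  have hr0 : ∑ x ∈ C, ∑ y ∈ C, (if x = y then 0 else hypercubeR (inner ℝ x y)) = 0 := by
    linarith
  have h10 : ∑ x ∈ C, ∑ y ∈ C, (inner ℝ x y) ^ 1 = 0 := by linarith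
  have h30 : ∑ x ∈ C, ∑ y ∈ C, (inner ℝ x y) ^ 3 = 0 := by linarith
  have h20 : ∑ x ∈ C, ∑ y ∈ C, (inner ℝ x y) ^ 2 = 64 := by linarith
  refine ⟨hcard, hC, ?_, by simpa using sum_inner_pow_eq_zero h10, sum_inner_pow_eq_zero h30,
    sum_inner_smul hcard hC h20⟩
  intro x hx y hy hxy
  rw [Finset.sum_eq_zero_iff_of_nonneg fun x hx => Finset.sum_nonneg (hterm x hx)] at hr0
  have := (Finset.sum_eq_zero_iff_of_nonneg (hterm x hx)).1 (hr0 x hx) y hy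
  rw [if_neg hxy] at this
  refine hypercubeR_eq_zero this fun h1 => hxy ?_
  exact (inner_eq_one_iff_of_norm_eq_one (hC x hx) (hC y hy)).1 h1

namespace IsTightConfig

variable {C : Finset (EuclideanSpace ℝ (Fin 4))}
  {x y z p a b c y₁ y₂ y₃ : EuclideanSpace ℝ (Fin 4)}

lemma inner_self (h : IsTightConfig C) (hx : x ∈ C) : inner ℝ x x = 1 := by
  rw [real_inner_self_eq_norm_sq, h.norm_eq x hx, one_pow]

lemma frame_sq (h : IsTightConfig C) (u : EuclideanSpace ℝ (Fin 4)) :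
    ∑ z ∈ C, (inner ℝ u z) ^ 2 = 4 * inner ℝ u u := by
  have := congrArg (inner ℝ u) (h.frame u)
  simpa only [inner_sum, inner_smul_right, ← sq] using this

lemma card_filter_inner (h : IsTightConfig C) (hx : x ∈ C) :
    (C.filter fun z => inner ℝ x z = -1).card = 1 ∧
    (C.filter fun z => inner ℝ x z = 1 / 2).card = 4 ∧
    (C.filter fun z => inner ℝ x z = -1 / 2).card = 4 := by
  have h1 := h.sum_inner x
  have h3 := h.sum_inner_cube x
  have h2 := h.frame_sq x
  rw [h.inner_self hx] at h2
  have e : ∑ z ∈ C, (if x = z then (1 : ℝ) else 0) = 1 := by simp [hx]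
  have key : ∀ f : ℝ → ℝ, f 0 = 0 → ∑ z ∈ C, f (inner ℝ x z) =
      f 1 + f (-1) * (C.filter fun z => inner ℝ x z = -1).card
      + f (1 / 2) * (C.filter fun z => inner ℝ x z = 1 / 2).card
      + f (-1 / 2) * (C.filter fun z => inner ℝ x z = -1 / 2).card := by
    intro f hf
    have hf1 : f 1 = f 1 * ∑ z ∈ C, (if x = z then (1 : ℝ) else 0) := by rw [e, mul_one]
    rw [hf1]
    simp only [Finset.card_filter, Nat.cast_sum, Finset.mul_sum, ← Finset.sum_add_distrib]
    refine Finset.sum_congr rfl fun z hz => ?_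
    by_cases hxz : x = z
    · subst hxz
      rw [h.inner_self hx]
      norm_num
    · rcases h.inner_mem x hx z hz hxz with h | h | h | h <;> rw [h] <;> norm_num [hxz, hf]
  rw [key (fun t => t) rfl] at h1
  rw [key (fun t => t ^ 3) (by norm_num)] at h3
  rw [key (fun t => t ^ 2) (by norm_num)] at h2
  refine ⟨?_, ?_, ?_⟩ <;> rify <;> linarith

lemma neg_mem (h : IsTightConfig C) (hx : x ∈ C) : -x ∈ C := by
  obtain ⟨z, hz⟩ := Finset.card_eq_one.1 (h.card_filter_inner hx).1
  obtain ⟨hzC, hxz⟩ := Finset.mem_filter.1 (hz ▸ Finset.mem_singleton_self z)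
  rw [inner_eq_neg_one_iff_of_norm_eq_one (h.norm_eq x hx) (h.norm_eq z hzC)] at hxz
  rwa [hxz, neg_neg]

lemma inner_cases (h : IsTightConfig C) (hx : x ∈ C) (hy : y ∈ C) :
    y = x ∨ y = -x ∨ inner ℝ x y = 1 / 2 ∨ inner ℝ x y = -1 / 2 ∨ inner ℝ x y = 0 := by
  by_cases hxy : x = y
  · exact Or.inl hxy.symm
  · rcases h.inner_mem x hx y hy hxy with hcase | hcase | hcase | hcase
    · simp [hcase]
    · simp [hcase]
    · simp [hcase]
    · rw [inner_eq_neg_one_iff_of_norm_eq_one (h.norm_eq x hx) (h.norm_eq y hy)] at hcase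
      simp [hcase]

/-- The neighbours of a point at inner product `1/2` sum to twice that point. -/
lemma sum_neighbors (h : IsTightConfig C) (hx : x ∈ C) :
    ∑ z ∈ C.filter (fun z => inner ℝ x z = 1 / 2), z = (2 : ℝ) • x := by
  have e : ∑ z ∈ C, (if x = z then z else 0) = x := by simp [hx]
  have e' : ∑ z ∈ C, (if -x = z then z else 0) = -x := by simp [h.neg_mem hx]
  have hn : ∑ z ∈ C, (if inner ℝ x z = -1 / 2 then z else 0) =
      -∑ z ∈ C, (if inner ℝ x z = 1 / 2 then z else 0) := by
    rw [← Finset.sum_neg_distrib]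
    refine Finset.sum_nbij' (fun z => -z) (fun z => -z) (fun z hz => h.neg_mem hz)
      (fun z hz => h.neg_mem hz) (by simp) (by simp) fun z _ => ?_
    have hz : inner ℝ x (-z) = 1 / 2 ↔ inner ℝ x z = -1 / 2 := by
      rw [inner_neg_right]
      constructor <;> intro <;> linarith
    simp only [hz]
    split_ifs <;> simp
  have hx0 : x ≠ -x := by
    intro h0
    have := h.inner_self hx
    nth_rewrite 2 [h0] at this
    rw [inner_neg_right, h.inner_self hx] at this
    norm_num at this
  have key : ∑ z ∈ C, (inner ℝ x z) • z = (∑ z ∈ C, (if x = z then z else 0))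
      - (∑ z ∈ C, (if -x = z then z else 0))
      + (1 / 2 : ℝ) • (∑ z ∈ C, (if inner ℝ x z = 1 / 2 then z else 0))
      - (1 / 2 : ℝ) • ∑ z ∈ C, (if inner ℝ x z = -1 / 2 then z else 0) := by
    simp only [Finset.smul_sum, ← Finset.sum_add_distrib, ← Finset.sum_sub_distrib]
    refine Finset.sum_congr rfl fun z hz => ?_
    rcases h.inner_cases hx hz with rfl | rfl | hcase | hcase | hcase
    · rw [h.inner_self hx]
      norm_num [hx0.symm]
    · rw [inner_neg_right, h.inner_self hx]
      norm_num [hx0]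
    all_goals
      have h1 : x ≠ z := by
        rintro rfl
        rw [h.inner_self hx] at hcase
        norm_num at hcase
      have h2 : -x ≠ z := by
        rintro rfl
        rw [inner_neg_right, h.inner_self hx] at hcase
        norm_num at hcase
      rw [hcase]
      norm_num [h1, h2]
  rw [h.frame, e, e', hn] at key
  rw [Finset.sum_filter]
  set S := ∑ z ∈ C, (if inner ℝ x z = 1 / 2 then z else 0)
  calc S = (x - -x + (1 / 2 : ℝ) • S - (1 / 2 : ℝ) • -S) - (2 : ℝ) • x := by module
    _ = (2 : ℝ) • x := by rw [← key]; module

/-- Three neighbours of a point determine the fourth. -/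
lemma exists_fourth (h : IsTightConfig C) (hx : x ∈ C) (ha : a ∈ C) (hb : b ∈ C) (hc : c ∈ C)
    (hxa : inner ℝ x a = 1 / 2) (hxb : inner ℝ x b = 1 / 2) (hxc : inner ℝ x c = 1 / 2)
    (hab : a ≠ b) (hac : a ≠ c) (hbc : b ≠ c) :
    ∃ d ∈ C, inner ℝ x d = 1 / 2 ∧ d ≠ a ∧ d ≠ b ∧ d ≠ c ∧ a + b + c + d = (2 : ℝ) • x ∧
      ∀ q ∈ C, inner ℝ x q = 1 / 2 → q = a ∨ q = b ∨ q = c ∨ q = d := by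
  set P := C.filter fun z => inner ℝ x z = 1 / 2 with hP
  have haP : a ∈ P := by simp [hP, ha, hxa]
  have hbP : b ∈ P.erase a := by simp [hP, hb, hxb, hab.symm]
  have hcP : c ∈ (P.erase a).erase b := by simp [hP, hc, hxc, hac.symm, hbc.symm]
  have hcard : (((P.erase a).erase b).erase c).card = 1 := by
    rw [Finset.card_erase_of_mem hcP, Finset.card_erase_of_mem hbP, Finset.card_erase_of_mem haP,
      (h.card_filter_inner hx).2.1]
  obtain ⟨d, hd⟩ := Finset.card_eq_one.1 hcard
  have hdm : d ∈ ((P.erase a).erase b).erase c := hd ▸ Finset.mem_singleton_self d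
  have hsum := h.sum_neighbors hx
  rw [← hP, ← Finset.add_sum_erase _ _ haP, ← Finset.add_sum_erase _ _ hbP,
    ← Finset.add_sum_erase _ _ hcP, hd, Finset.sum_singleton] at hsum
  simp only [Finset.mem_erase, hP, Finset.mem_filter] at hdm
  refine ⟨d, hdm.2.2.2.1, hdm.2.2.2.2, hdm.2.2.1, hdm.2.1, hdm.1, ?_, ?_⟩
  · rw [← hsum]
    abel
  · intro q hq hxq
    by_contra! hne
    have : q ∈ ((P.erase a).erase b).erase c := by simp [hP, hq, hxq, hne]
    rw [hd, Finset.mem_singleton] at this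
    exact hne.2.2.2 this

lemma inner_eq_zero_of_notMem (h : IsTightConfig C) {S : Finset (EuclideanSpace ℝ (Fin 4))}
    (hS : ∀ q ∈ S, -q ∈ S) (hx : x ∈ C) (hxS : x ∈ S)
    (hnS : ∀ q ∈ C, inner ℝ x q = 1 / 2 → q ∈ S) (hp : p ∈ C) (hpS : p ∉ S) :
    inner ℝ x p = 0 := by
  rcases h.inner_cases hx hp with rfl | rfl | hcase | hcase | hcase
  · exact absurd hxS hpS
  · exact absurd (hS _ hxS) hpS
  · exact absurd (hnS p hp hcase) hpS
  · refine absurd (hS _ (hnS (-p) (h.neg_mem hp) ?_)) (by rwa [neg_neg])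
    rw [inner_neg_right, hcase]
    norm_num
  · exact hcase

/-- No point is orthogonal to all neighbours, at inner product `1/2`, of another point. -/
lemma exists_inner_ne_zero (h : IsTightConfig C) (hx : x ∈ C) (hp : p ∈ C) :
    ∃ q ∈ C, inner ℝ x q = 1 / 2 ∧ inner ℝ p q ≠ 0 := by
  by_contra! H
  have H' : ∀ q ∈ C, inner ℝ x q = -1 / 2 → inner ℝ p q = 0 := by
    intro q hq hxq
    have := H (-q) (h.neg_mem hq) (by rw [inner_neg_right, hxq]; norm_num)
    rwa [inner_neg_right, neg_eq_zero] at this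
  have hdisj : ∀ s t : ℝ, s ≠ t → ∀ w : EuclideanSpace ℝ (Fin 4),
      Disjoint (C.filter fun z => inner ℝ w z = s) (C.filter fun z => inner ℝ w z = t) := by
    intro s t hst w
    refine Finset.disjoint_filter.2 fun z _ h1 h2 => hst (h1.symm.trans h2)
  have hX := Finset.card_union_of_disjoint (hdisj (1 / 2) (-1 / 2) (by norm_num) x)
  have hP := Finset.card_union_of_disjoint (hdisj (1 / 2) (-1 / 2) (by norm_num) p)
  have hP' := Finset.card_union_of_disjoint (hdisj 1 (-1) (by norm_num) p)
  have hpx := h.card_filter_inner hx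
  have hpp := h.card_filter_inner hp
  have hp1 : 0 < (C.filter fun z => inner ℝ p z = 1).card :=
    Finset.card_pos.2 ⟨p, Finset.mem_filter.2 ⟨hp, h.inner_self hp⟩⟩
  have d1 : Disjoint
      ((C.filter fun z => inner ℝ p z = 1 / 2) ∪ (C.filter fun z => inner ℝ p z = -1 / 2))
      ((C.filter fun z => inner ℝ p z = 1) ∪ (C.filter fun z => inner ℝ p z = -1)) := by
    simp only [Finset.disjoint_union_left, Finset.disjoint_union_right]
    refine ⟨⟨hdisj _ _ ?_ _, hdisj _ _ ?_ _⟩, hdisj _ _ ?_ _, hdisj _ _ ?_ _⟩ <;> norm_num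
  have d2 : Disjoint
      ((C.filter fun z => inner ℝ x z = 1 / 2) ∪ (C.filter fun z => inner ℝ x z = -1 / 2))
      (((C.filter fun z => inner ℝ p z = 1 / 2) ∪ (C.filter fun z => inner ℝ p z = -1 / 2)) ∪
      ((C.filter fun z => inner ℝ p z = 1) ∪ (C.filter fun z => inner ℝ p z = -1))) := by
    refine Finset.disjoint_left.2 fun z hz hz' => ?_
    have h0 : inner ℝ p z = 0 := by
      rcases Finset.mem_union.1 hz with hz | hz
      · exact H z (Finset.mem_filter.1 hz).1 (Finset.mem_filter.1 hz).2
      · exact H' z (Finset.mem_filter.1 hz).1 (Finset.mem_filter.1 hz).2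
    simp only [Finset.mem_union, Finset.mem_filter, h0] at hz'
    norm_num at hz'
  have hle : (((C.filter fun z => inner ℝ x z = 1 / 2) ∪ (C.filter fun z => inner ℝ x z = -1 / 2)) ∪
      (((C.filter fun z => inner ℝ p z = 1 / 2) ∪ (C.filter fun z => inner ℝ p z = -1 / 2)) ∪
      ((C.filter fun z => inner ℝ p z = 1) ∪ (C.filter fun z => inner ℝ p z = -1)))).card
      ≤ C.card := by
    refine Finset.card_le_card ?_
    simp only [Finset.union_subset_iff, Finset.filter_subset, and_self]
  rw [Finset.card_union_of_disjoint d2, Finset.card_union_of_disjoint d1, h.card_eq] at hle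
  omega

/-- Two neighbours of a point, at inner product `1/2` from it, are at one of three angles. -/
lemma inner_neighbors (h : IsTightConfig C) (hy : y ∈ C) (hz : z ∈ C)
    (hxy : inner ℝ x y = 1 / 2) (hxz : inner ℝ x z = 1 / 2) (hyz : y ≠ z) :
    inner ℝ y z = 1 / 2 ∨ inner ℝ y z = -1 / 2 ∨ inner ℝ y z = 0 := by
  rcases h.inner_cases hy hz with rfl | rfl | hcase
  · exact absurd rfl hyz
  · rw [inner_neg_right] at hxz
    linarith
  · exact hcase

/-- Three neighbours of a point cannot span a root system of type `A₃`. -/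
lemma not_inner_half_and_neg_half (h : IsTightConfig C) (hx : x ∈ C) (h₁ : y₁ ∈ C) (h₂ : y₂ ∈ C)
    (h₃ : y₃ ∈ C) (hx1 : inner ℝ x y₁ = 1 / 2) (hx2 : inner ℝ x y₂ = 1 / 2)
    (hx3 : inner ℝ x y₃ = 1 / 2) (h12 : inner ℝ y₁ y₂ = 1 / 2) (h13 : inner ℝ y₁ y₃ = -1 / 2) :
    False := by
  have hxx := h.inner_self hx
  have h11 := h.inner_self h₁
  have h22 := h.inner_self h₂
  have hy3 : y₃ = x - y₁ := by
    rw [← sub_eq_zero, ← inner_self_eq_zero (𝕜 := ℝ)]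
    simp only [inner_sub_left, inner_sub_right, h.inner_self h₃, hxx, h11, hx1, hx3, h13,
      real_inner_comm x, real_inner_comm y₁]
    norm_num
  subst hy3
  have n12 : y₁ ≠ y₂ := by rintro rfl; linarith
  have n13 : y₁ ≠ x - y₁ := by intro e; rw [← e] at h13; linarith
  have n23 : y₂ ≠ x - y₁ := by intro e; rw [← e] at h13; linarith
  obtain ⟨y₄, h₄, -, -, -, -, hsum, hPx⟩ := h.exists_fourth hx h₁ h₂ h₃ hx1 hx2 hx3 n12 n13 n23
  obtain rfl : y₄ = x - y₂ := by rw [eq_sub_of_add_eq' hsum]; module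
  have h1x : inner ℝ y₁ x = 1 / 2 := by rw [real_inner_comm, hx1]
  have h2x : inner ℝ y₂ x = 1 / 2 := by rw [real_inner_comm, hx2]
  have h21 : inner ℝ y₂ y₁ = 1 / 2 := by rw [real_inner_comm, h12]
  have hN : ∀ w ∈ C, ∀ v, x - v = w → v - x ∈ C := by
    rintro w hw v rfl
    simpa using h.neg_mem hw
  have nx : ∀ v w, inner ℝ x v = 1 / 2 → inner ℝ x w = 1 / 2 → x ≠ v ∧ x ≠ w - x ∧ v ≠ w - x := by
    intro v w hv hw
    refine ⟨?_, ?_, ?_⟩ <;> intro e <;> have := congrArg (inner ℝ x) e <;>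
      simp only [inner_sub_right, hxx, hv, hw] at this <;> norm_num at this
  obtain ⟨u, -, -, -, -, -, hu, hP₁⟩ := h.exists_fourth h₁ hx h₂ (hN _ h₃ _ rfl) h1x h12
    (by rw [inner_sub_right, h11, h1x]; norm_num) (nx _ y₁ hx2 hx1).1 (nx _ _ hx2 hx1).2.1
    (nx _ _ hx2 hx1).2.2
  obtain rfl : u = y₁ - y₂ := by rw [eq_sub_of_add_eq' hu]; module
  obtain ⟨v, -, -, -, -, -, hv, hP₂⟩ := h.exists_fourth h₂ hx h₁ (hN _ h₄ _ rfl) h2x h21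
    (by rw [inner_sub_right, h22, h2x]; norm_num) (nx _ y₁ hx1 hx1).1 (nx _ _ hx1 hx2).2.1
    (nx _ _ hx1 hx2).2.2
  obtain rfl : v = y₂ - y₁ := by rw [eq_sub_of_add_eq' hv]; module
  let T : Finset (EuclideanSpace ℝ (Fin 4)) := {x, y₁, y₂, x - y₁, x - y₂, y₁ - y₂}
  have hT : (T ∪ T.image Neg.neg).card < C.card := by
    have hT6 : T.card ≤ 6 := Finset.card_le_six
    have := Finset.card_union_le T (T.image Neg.neg)
    have := Finset.card_image_le (s := T) (f := Neg.neg)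
    rw [h.card_eq]
    omega
  obtain ⟨p, hp, hpS⟩ := Finset.exists_mem_notMem_of_card_lt_card hT
  have hS : ∀ q ∈ T ∪ T.image Neg.neg, -q ∈ T ∪ T.image Neg.neg := by
    intro q hq
    rcases Finset.mem_union.1 hq with hq | hq
    · exact Finset.mem_union_right _ (Finset.mem_image_of_mem _ hq)
    · obtain ⟨w, hw, rfl⟩ := Finset.mem_image.1 hq
      rw [neg_neg]
      exact Finset.mem_union_left _ hw
  have hpx : inner ℝ x p = 0 := by
    refine h.inner_eq_zero_of_notMem hS hx (by simp [T]) (fun q hq hxq => ?_) hp hpS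
    rcases hPx q hq hxq with rfl | rfl | rfl | rfl <;> simp [T]
  have hp1 : inner ℝ y₁ p = 0 := by
    refine h.inner_eq_zero_of_notMem hS h₁ (by simp [T]) (fun q hq hxq => ?_) hp hpS
    rcases hP₁ q hq hxq with rfl | rfl | rfl | rfl <;> simp [T]
  have hp2 : inner ℝ y₂ p = 0 := by
    refine h.inner_eq_zero_of_notMem hS h₂ (by simp [T]) (fun q hq hxq => ?_) hp hpS
    rcases hP₂ q hq hxq with rfl | rfl | rfl | rfl <;> simp [T]
  obtain ⟨q, hq, hxq, hpq⟩ := h.exists_inner_ne_zero hx hp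
  rw [real_inner_comm] at hpq
  rcases hPx q hq hxq with rfl | rfl | rfl | rfl <;> simp [inner_sub_left, *] at hpq

/-- Distinct neighbours of a point, at inner product `1/2` from it, are orthogonal. -/
lemma inner_neighbors_eq_zero (h : IsTightConfig C) (hx : x ∈ C) (hy : y ∈ C) (hz : z ∈ C)
    (hxy : inner ℝ x y = 1 / 2) (hxz : inner ℝ x z = 1 / 2) (hyz : y ≠ z) :
    inner ℝ y z = 0 := by
  have hne : (((C.filter fun w => inner ℝ x w = 1 / 2).erase y).erase z).Nonempty := by
    rw [← Finset.card_pos, Finset.card_erase_of_mem, Finset.card_erase_of_mem,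
      (h.card_filter_inner hx).2.1]
    · norm_num
    · simp [hy, hxy]
    · simp [hz, hxz, hyz.symm]
  obtain ⟨c, hc⟩ := hne
  simp only [Finset.mem_erase, Finset.mem_filter] at hc
  obtain ⟨hcz, hcy, hc, hxc⟩ := hc
  obtain ⟨d, hd, hxd, hdy, -, -, hsum, -⟩ :=
    h.exists_fourth hx hy hz hc hxy hxz hxc hyz hcy.symm hcz.symm
  have hs := congrArg (inner ℝ y) hsum
  simp only [inner_add_right, inner_smul_right, h.inner_self hy, real_inner_comm x y, hxy] at hs
  have no := fun {a b} (ha : a ∈ C) (hb : b ∈ C) hxa hxb hya hyb =>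
    h.not_inner_half_and_neg_half (y₂ := a) (y₃ := b) hx hy ha hb hxy hxa hxb hya hyb
  rcases h.inner_neighbors hy hz hxy hxz hyz with h1 | h1 | h1
  · rcases h.inner_neighbors hy hc hxy hxc hcy.symm with h2 | h2 | h2
    · rcases h.inner_neighbors hy hd hxy hxd hdy.symm with h3 | h3 | h3 <;> linarith
    · exact (no hz hc hxz hxc h1 h2).elim
    · exact (no hz hd hxz hxd h1 (by linarith)).elim
  · rcases h.inner_neighbors hy hc hxy hxc hcy.symm with h2 | h2 | h2
    · exact (no hc hz hxc hxz h2 h1).elim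
    · rcases h.inner_neighbors hy hd hxy hxd hdy.symm with h3 | h3 | h3 <;> linarith
    · exact (no hd hz hxd hxz (by linarith) h1).elim
  · exact h1

/-- Differences of neighbours meet every point at inner product `±1/2`. -/
lemma inner_sub_sq (h : IsTightConfig C) (hx : x ∈ C) (hy : y ∈ C) (hxy : inner ℝ x y = 1 / 2)
    (hz : z ∈ C) : (inner ℝ (x - y) z) ^ 2 = 1 / 4 := by
  have hyx : inner ℝ y x = 1 / 2 := by rw [real_inner_comm, hxy]
  have hle : ∀ z ∈ C, (inner ℝ (x - y) z) ^ 2 ≤ 1 / 4 := by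
    intro z hz
    rw [inner_sub_left]
    rcases h.inner_cases hy hz with rfl | rfl | hyz
    · rw [hxy, h.inner_self hy]; norm_num
    · rw [inner_neg_right, inner_neg_right, hxy, h.inner_self hy]; norm_num
    have hne : y ≠ z := by rintro rfl; rw [h.inner_self hy] at hyz; norm_num at hyz
    have hne' : y ≠ -z := by
      intro e
      obtain rfl : z = -y := by rw [e, neg_neg]
      rw [inner_neg_right, h.inner_self hy] at hyz
      norm_num at hyz
    rcases h.inner_cases hx hz with rfl | rfl | hxz | hxz | hxz
    · rw [hyx, h.inner_self hx]; norm_num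
    · rw [inner_neg_right, inner_neg_right, hyx, h.inner_self hx]; norm_num
    · rw [h.inner_neighbors_eq_zero hx hy hz hxy hxz hne, hxz]; norm_num
    · have := h.inner_neighbors_eq_zero hx hy (h.neg_mem hz) hxy
        (by rw [inner_neg_right, hxz]; norm_num) hne'
      rw [inner_neg_right, neg_eq_zero] at this
      rw [this, hxz]; norm_num
    · rw [hxz]
      rcases hyz with hcase | hcase | hcase <;> rw [hcase] <;> norm_num
  refine (Finset.sum_eq_sum_iff_of_le hle).1 ?_ z hz
  rw [h.frame_sq, Finset.sum_const, h.card_eq]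
  simp only [inner_sub_left, inner_sub_right, h.inner_self hx, h.inner_self hy, hxy, hyx]
  norm_num

lemma isOrthImage_hypercubeConfig (h : IsTightConfig C) : isOrthImage hypercubeConfig C := by
  obtain ⟨x, hx⟩ : C.Nonempty := by rw [← Finset.card_pos, h.card_eq]; norm_num
  let y := (Finset.equivFinOfCardEq (h.card_filter_inner hx).2.1).symm
  have hy : ∀ i, (y i : EuclideanSpace ℝ (Fin 4)) ∈ C ∧
      inner ℝ x (y i : EuclideanSpace ℝ (Fin 4)) = 1 / 2 := fun i => Finset.mem_filter.1 (y i).2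
  have hon : Orthonormal ℝ fun i => x - (y i : EuclideanSpace ℝ (Fin 4)) := by
    rw [orthonormal_iff_ite]
    intro i j
    simp only [inner_sub_left, inner_sub_right, h.inner_self hx, (hy _).2,
      real_inner_comm x (y _ : EuclideanSpace ℝ (Fin 4))]
    split_ifs with hij
    · subst hij
      rw [h.inner_self (hy i).1]
      norm_num
    · rw [h.inner_neighbors_eq_zero hx (hy i).1 (hy j).1 (hy i).2 (hy j).2
        fun e => hij (y.injective (Subtype.ext e))]
      norm_num
  let b := (basisOfOrthonormalOfCardEqFinrank hon (by simp)).toOrthonormalBasis (by simpa using hon)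
  have hb : ∀ i, b i = x - y i := by simp [b]
  refine ⟨b.repr.symm, Finset.eq_of_subset_of_card_le (fun z hz => ?_) ?_⟩
  · refine Finset.mem_image.2 ⟨b.repr z, ?_, by simp⟩
    refine Finset.mem_image.2 ⟨fun i => decide (inner ℝ (b i) z = 1 / 2), Finset.mem_univ _, ?_⟩
    ext i
    have hi := h.inner_sub_sq hx (hy i).1 (hy i).2 hz
    rw [← hb, show (1 / 4 : ℝ) = (1 / 2) ^ 2 by norm_num, sq_eq_sq_iff_eq_or_eq_neg] at hi
    rw [b.repr_apply_apply]
    rcases hi with hi | hi <;> rw [WithLp.equiv_symm_apply] <;> norm_num [hi]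
  · rw [h.card_eq]
    exact Finset.card_image_le.trans (Finset.card_image_le.trans (by simp))

end IsTightConfig

/-- Theorem 4: the hypercube is the unique global energy minimizer of `hypercubeV`
among 16-point configurations on `S³`. -/
theorem hypercube_unique_ground_state :
    ∀ C : Finset (EuclideanSpace ℝ (Fin 4)), C.card = 16 → onSphere C →
      energy hypercubeV hypercubeConfig ≤ energy hypercubeV C ∧
      (energy hypercubeV C = energy hypercubeV hypercubeConfig →
        isOrthImage hypercubeConfig C) := by
  intro C hcard hC
  rw [energy_hypercubeConfig]
  obtain ⟨hle, heq⟩ := isTightConfig_of_energy_le hcard hC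
  exact ⟨hle, fun h => (heq h).isOrthImage_hypercubeConfig⟩
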